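/- arXiv:2504.04125 — 8 statements merged into one kernel-verified Lean document; each statement's English description precedes it below -/
import Mathlib

section
/- Let n, m be positive integers and let x, x' be complex (2n)×m matrices. There exist a matrix S in the symplectic group Sp(2n,ℂ) (with respect to J) and an invertible complex m×m matrix h such that x' = S·x·h if and only if rank(x) = rank(x') and rank(xᵀ·J·x) = rank(x'ᵀ·J·x'). (This says that the sets O_{rs} = {x : rank x = r, rank(xᵀJx) = s} are exactly the orbits of Sp(2n,ℂ)×GL(m,ℂ) acting on (2n)×m matrices by (S,h)·x = S·x·h⁻¹.) -/
open Matrix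

/-- The standard symplectic matrix `J = [[0, 1ₙ], [-1ₙ, 0]]`. -/
def symJ (n : ℕ) : Matrix (Fin n ⊕ Fin n) (Fin n ⊕ Fin n) ℂ :=
  Matrix.fromBlocks 0 1 (-1) 0

section AlternatingForm

open Module LinearMap

variable {K V V' : Type*} [Field K] [AddCommGroup V] [Module K V] [AddCommGroup V'] [Module K V']

namespace Submodule

theorem finrank_comap_subtype (U W : Submodule K V) :
    finrank K (W.comap U.subtype) = finrank K (W ⊓ U : Submodule K V) := by
  have h : W.comap U.subtype = (W ⊓ U).comap U.subtype := by ext; simp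
  rw [h]
  exact (comapSubtypeEquivOfLe inf_le_right).finrank_eq

theorem finrank_map_add_finrank_inf_ker [FiniteDimensional K V] (f : V →ₗ[K] V')
    (W : Submodule K V) :
    finrank K (W.map f) + finrank K (W ⊓ ker f : Submodule K V) = finrank K W := by
  have h := finrank_range_add_finrank_ker (f.domRestrict W)
  rwa [range_domRestrict, ker_domRestrict, finrank_comap_subtype, inf_comm] at h

end Submodule

/-- Linear maps from a finite-dimensional space with the same range differ by an automorphism of
the source. -/
theorem LinearMap.exists_linearEquiv_comp_eq_of_range_eq [FiniteDimensional K V]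
    {f g : V →ₗ[K] V'} (h : range f = range g) : ∃ e : V ≃ₗ[K] V, g = f ∘ₗ e := by
  obtain ⟨p, hp⟩ := (ker f).exists_isCompl
  obtain ⟨q, hq⟩ := (ker g).exists_isCompl
  have hker : finrank K (ker g) = finrank K (ker f) := by
    have hf := finrank_range_add_finrank_ker f
    have hg := finrank_range_add_finrank_ker g
    rw [h] at hf
    omega
  let eker : ker g ≃ₗ[K] ker f := LinearEquiv.ofFinrankEq _ _ hker
  let ep : p ≃ₗ[K] range f :=
    (Submodule.quotientEquivOfIsCompl _ p hp).symm ≪≫ₗ f.quotKerEquivRange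
  let emapq : q ≃ₗ[K] range g :=
    (Submodule.quotientEquivOfIsCompl _ q hq).symm ≪≫ₗ g.quotKerEquivRange
  let ecompl : q ≃ₗ[K] p := emapq ≪≫ₗ LinearEquiv.ofEq _ _ h.symm ≪≫ₗ ep.symm
  have hep : ∀ y : p, (ep y : V') = f y := fun y => by simp [ep]
  have hemapq : ∀ y : q, (emapq y : V') = g y := fun y => by simp [emapq]
  have hcompl : ∀ y : q, f (ecompl y) = g y := fun y => by
    rw [← hep, ← hemapq]
    simp [ecompl]
  refine ⟨(Submodule.prodEquivOfIsCompl _ q hq).symm ≪≫ₗ eker.prodCongr ecompl ≪≫ₗ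
    Submodule.prodEquivOfIsCompl _ p hp, ?_⟩
  ext z
  obtain ⟨⟨a, b⟩, rfl⟩ := (Submodule.prodEquivOfIsCompl _ q hq).surjective z
  have ha : g a = 0 := a.2
  have ha' : f (eker a) = 0 := (eker a).2
  simp only [coe_comp, LinearEquiv.coe_coe, Function.comp_apply, LinearEquiv.trans_apply,
    LinearEquiv.symm_apply_apply]
  simp only [LinearEquiv.prodCongr_apply, Submodule.coe_prodEquivOfIsCompl', map_add, ha, ha',
    hcompl]

namespace LinearMap.BilinForm

/-- The radical of the restriction of a bilinear form to a subspace. -/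
def radicalOn (B : LinearMap.BilinForm K V) (W : Submodule K V) : Submodule K V :=
  W ⊓ W.orthogonalBilin B

theorem mem_radicalOn {B : LinearMap.BilinForm K V} {W : Submodule K V} {x : V} :
    x ∈ B.radicalOn W ↔ x ∈ W ∧ ∀ y ∈ W, B y x = 0 := Iff.rfl

/-- The common kernel of the functionals `B u` and `B v`. -/
def pairCompl (B : LinearMap.BilinForm K V) (u v : V) : Submodule K V := ker (B u) ⊓ ker (B v)

theorem mem_pairCompl {B : LinearMap.BilinForm K V} {u v x : V} :
    x ∈ B.pairCompl u v ↔ B u x = 0 ∧ B v x = 0 := Iff.rfl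

variable {B : LinearMap.BilinForm K V} {B' : LinearMap.BilinForm K V'} {u' v' : V'} {u v : V}

/-- The splitting of a space along a hyperbolic pair `u, v` of an alternating form. -/
def hyperbolicEquiv (hB : B.IsAlt) (huv : B u v = 1) :
    (K × K × B.pairCompl u v) ≃ₗ[K] V where
  toFun z := z.1 • u + z.2.1 • v + z.2.2
  map_add' y z := by simp only [Prod.fst_add, Prod.snd_add, Submodule.coe_add]; module
  map_smul' c z := by
    simp only [Prod.smul_fst, Prod.smul_snd, Submodule.coe_smul, smul_eq_mul, RingHom.id_apply]
    module
  invFun x := (-B v x, B u x, ⟨x + B v x • u - B u x • v, by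
    have hvu : B v u = -1 := by rw [← hB.neg_eq, huv]
    simp [mem_pairCompl, hB.self_eq_zero, huv, hvu]⟩)
  left_inv := by
    rintro ⟨a, b, w, hw⟩
    have hvu : B v u = -1 := by rw [← hB.neg_eq, huv]
    have h := mem_pairCompl.1 hw
    simp only [map_add, map_smul, hB.self_eq_zero, huv, hvu, h.1, h.2, smul_eq_mul]
    ext
    · simp
    · simp
    · simp only [mul_neg, mul_one, mul_zero, add_zero, zero_add]
      module
  right_inv x := by
    simp only
    module

theorem hyperbolicEquiv_apply (hB : B.IsAlt) (huv : B u v = 1) (a b : K)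
    (w : B.pairCompl u v) : hyperbolicEquiv hB huv (a, b, w) = a • u + b • v + w := rfl

theorem apply_hyperbolicEquiv (hB : B.IsAlt) (huv : B u v = 1) (a b c d : K)
    (w z : B.pairCompl u v) :
    B (hyperbolicEquiv hB huv (a, b, w)) (hyperbolicEquiv hB huv (c, d, z)) =
      a * d - b * c + B w z := by
  have hvu : B v u = -1 := by rw [← hB.neg_eq, huv]
  have hw := mem_pairCompl.1 w.2
  have hz := mem_pairCompl.1 z.2
  rw [hB.eq_iff, hB.eq_iff (x := v)] at hw
  simp only [hyperbolicEquiv_apply, map_add, map_smul, LinearMap.add_apply, LinearMap.smul_apply,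
    smul_eq_mul, hB.self_eq_zero, huv, hvu, hw, hz]
  ring

theorem separatingLeft_pairCompl (hB : B.IsAlt) (hs : B.SeparatingLeft) (huv : B u v = 1) :
    (B.restrict (B.pairCompl u v)).SeparatingLeft := by
  intro w hw
  have h0 : hyperbolicEquiv hB huv (0, 0, w) = 0 := by
    refine hs _ fun y => ?_
    obtain ⟨⟨a, b, z⟩, rfl⟩ := (hyperbolicEquiv hB huv).surjective y
    rw [apply_hyperbolicEquiv]
    simpa using hw z
  simpa [hyperbolicEquiv_apply] using h0

/-- An isometry between the complements of two hyperbolic pairs extends to the whole spaces. -/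
theorem exists_isometry_extending (hB : B.IsAlt) (hB' : B'.IsAlt) (huv : B u v = 1)
    (huv' : B' u' v' = 1) (e : B.pairCompl u v ≃ₗ[K] B'.pairCompl u' v')
    (he : ∀ x y, B' (e x) (e y) = B x y) :
    ∃ f : V ≃ₗ[K] V', (∀ x y, B' (f x) (f y) = B x y) ∧
      ∀ (a b : K) (w : B.pairCompl u v),
        f (hyperbolicEquiv hB huv (a, b, w)) = hyperbolicEquiv hB' huv' (a, b, e w) := by
  let f : V ≃ₗ[K] V' := (hyperbolicEquiv hB huv).symm ≪≫ₗ
    (LinearEquiv.refl K K).prodCongr ((LinearEquiv.refl K K).prodCongr e) ≪≫ₗ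
    hyperbolicEquiv hB' huv'
  have hf : ∀ (a b : K) (w : B.pairCompl u v),
      f (hyperbolicEquiv hB huv (a, b, w)) = hyperbolicEquiv hB' huv' (a, b, e w) := by
    intro a b w
    simp [f]
  refine ⟨f, fun x y => ?_, hf⟩
  obtain ⟨⟨a, b, w⟩, rfl⟩ := (hyperbolicEquiv hB huv).surjective x
  obtain ⟨⟨c, d, z⟩, rfl⟩ := (hyperbolicEquiv hB huv).surjective y
  rw [hf, hf, apply_hyperbolicEquiv, apply_hyperbolicEquiv, he]

theorem hyperbolicEquiv_mem_iff (hB : B.IsAlt) (huv : B u v = 1) {W : Submodule K V}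
    (hu : u ∈ W) (hv : v ∈ W) (a b : K) (w : B.pairCompl u v) :
    hyperbolicEquiv hB huv (a, b, w) ∈ W ↔ (w : V) ∈ W :=
  W.add_mem_iff_right (W.add_mem (W.smul_mem a hu) (W.smul_mem b hv))

theorem hyperbolicEquiv_mem_iff_of_isotropic (hB : B.IsAlt) (huv : B u v = 1)
    {W : Submodule K V} (hu : u ∈ W) (hW : ∀ x ∈ W, B u x = 0) (a b : K)
    (w : B.pairCompl u v) :
    hyperbolicEquiv hB huv (a, b, w) ∈ W ↔ b = 0 ∧ (w : V) ∈ W := by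
  rw [hyperbolicEquiv_apply, add_assoc, W.add_mem_iff_right (W.smul_mem a hu)]
  constructor
  · intro h
    have hb : b = 0 := by
      simpa [huv, (mem_pairCompl.1 w.2).1] using hW _ h
    subst hb
    simpa using h
  · rintro ⟨rfl, h⟩
    simpa using h

theorem finrank_comap_pairCompl [FiniteDimensional K V] (hB : B.IsAlt) (huv : B u v = 1)
    {W : Submodule K V} (hu : u ∈ W) (hv : v ∈ W) :
    2 + finrank K (W.comap (B.pairCompl u v).subtype) = finrank K W := by
  have hvu : B v u = -1 := by rw [← hB.neg_eq, huv]
  have h := W.finrank_map_add_finrank_inf_ker ((B u).prod (B v))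
  have hmap : W.map ((B u).prod (B v)) = ⊤ := by
    refine eq_top_iff.2 fun ⟨a, b⟩ _ => ⟨a • v - b • u, W.sub_mem (W.smul_mem a hv)
      (W.smul_mem b hu), ?_⟩
    simp [hB.self_eq_zero, huv, hvu]
  rw [hmap, finrank_top, finrank_prod, finrank_self, ker_prod] at h
  rw [Submodule.finrank_comap_subtype]
  exact h

theorem finrank_comap_pairCompl_of_isotropic [FiniteDimensional K V] (hB : B.IsAlt)
    (huv : B u v = 1) {W : Submodule K V} (hu : u ∈ W) (hW : ∀ x ∈ W, B u x = 0) :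
    1 + finrank K (W.comap (B.pairCompl u v).subtype) = finrank K W := by
  have hvu : B v u = -1 := by rw [← hB.neg_eq, huv]
  have h := W.finrank_map_add_finrank_inf_ker (B v)
  have hmap : W.map (B v) = ⊤ :=
    eq_top_iff.2 fun a _ => ⟨-a • u, W.smul_mem _ hu, by simp [hvu]⟩
  have hinf : W ⊓ B.pairCompl u v = W ⊓ ker (B v) := by
    ext x
    simp only [Submodule.mem_inf, mem_pairCompl, mem_ker]
    exact ⟨fun h => ⟨h.1, h.2.2⟩, fun h => ⟨h.1, hW x h.1, h.2⟩⟩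
  rw [hmap, finrank_top, finrank_self] at h
  rwa [Submodule.finrank_comap_subtype, hinf]

theorem finrank_pairCompl [FiniteDimensional K V] (hB : B.IsAlt) (huv : B u v = 1) :
    2 + finrank K (B.pairCompl u v) = finrank K V := by
  have h := finrank_comap_pairCompl hB huv (W := ⊤) trivial trivial
  rwa [Submodule.comap_top, finrank_top, finrank_top] at h

theorem finrank_radicalOn_comap_pairCompl (hB : B.IsAlt) (huv : B u v = 1)
    {W : Submodule K V} (hu : u ∈ W) (hv : v ∈ W) :
    finrank K ((B.restrict (B.pairCompl u v)).radicalOn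
      (W.comap (B.pairCompl u v).subtype)) = finrank K (B.radicalOn W) := by
  have hle : B.radicalOn W ≤ B.pairCompl u v := fun x hx =>
    ⟨(mem_radicalOn.1 hx).2 u hu, (mem_radicalOn.1 hx).2 v hv⟩
  rw [← (Submodule.comapSubtypeEquivOfLe hle).finrank_eq]
  refine congrArg (fun R : Submodule K (B.pairCompl u v) => finrank K R) ?_
  ext w
  simp only [mem_radicalOn, Submodule.mem_comap, Submodule.subtype_apply]
  refine and_congr_right fun _ => ⟨fun h y hy => ?_, fun h y hy => h y hy⟩
  obtain ⟨⟨a, b, z⟩, rfl⟩ := (hyperbolicEquiv hB huv).surjective y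
  have hz := h z ((hyperbolicEquiv_mem_iff hB huv hu hv a b z).1 hy)
  have hw := apply_hyperbolicEquiv hB huv a b 0 0 z w
  simp only [hyperbolicEquiv_apply hB huv 0 0 w, zero_smul, zero_add] at hw
  rw [hw]
  simpa using hz

theorem exists_mem_apply_eq_one {W : Submodule K V} {x : V} (h : ∃ y ∈ W, B x y ≠ 0) :
    ∃ v ∈ W, B x v = 1 := by
  obtain ⟨y, hy, hxy⟩ := h
  exact ⟨(B x y)⁻¹ • y, W.smul_mem _ hy, by simp [hxy]⟩

theorem radicalOn_eq_self_iff {W : Submodule K V} :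
    B.radicalOn W = W ↔ ∀ x ∈ W, ∀ y ∈ W, B x y = 0 := by
  rw [radicalOn, inf_eq_left]
  exact ⟨fun h x hx y hy => h hy x hx, fun h y hy x hx => h x hx y hy⟩

theorem radicalOn_top (hB : B.IsAlt) (hs : B.SeparatingLeft) : B.radicalOn ⊤ = ⊥ :=
  eq_bot_iff.2 fun x hx => hs x fun y => hB.eq_iff.1 ((mem_radicalOn.1 hx).2 y trivial)

/-- Two subspaces of symplectic spaces of the same dimension are related by an isometry of the
ambient spaces as soon as they and their radicals have the same dimension. -/
theorem exists_isometry_mem_iff.{w, w'} (d : ℕ) :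
    ∀ (V : Type w) (V' : Type w') [AddCommGroup V] [Module K V] [AddCommGroup V'] [Module K V']
      [FiniteDimensional K V] [FiniteDimensional K V']
      (B : LinearMap.BilinForm K V) (B' : LinearMap.BilinForm K V')
      (W : Submodule K V) (W' : Submodule K V'),
      B.IsAlt → B'.IsAlt → B.SeparatingLeft → B'.SeparatingLeft →
      finrank K V = d → finrank K V' = d → finrank K W = finrank K W' →
      finrank K (B.radicalOn W) = finrank K (B'.radicalOn W') →
      ∃ e : V ≃ₗ[K] V', (∀ x y, B' (e x) (e y) = B x y) ∧ ∀ x, e x ∈ W' ↔ x ∈ W := by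
  induction d using Nat.strong_induction_on with
  | _ d ih =>
  intro V V' _ _ _ _ _ _ B B' W W' hB hB' hs hs' hd hd' hW hR
  have isotropic_iff : ∀ (W : Submodule K V) (W' : Submodule K V'),
      finrank K W = finrank K W' →
      finrank K (B.radicalOn W) = finrank K (B'.radicalOn W') →
      (B.radicalOn W = W ↔ B'.radicalOn W' = W') := by
    intro W W' hW hR
    constructor
    · intro h
      exact Submodule.eq_of_le_of_finrank_eq inf_le_left (by rw [← hR, ← hW, h])
    · intro h
      exact Submodule.eq_of_le_of_finrank_eq inf_le_left (by rw [hR, hW, h])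
  have of_not_isotropic : ∀ (W : Submodule K V) (W' : Submodule K V'),
      finrank K W = finrank K W' →
      finrank K (B.radicalOn W) = finrank K (B'.radicalOn W') → B.radicalOn W ≠ W →
      ∃ e : V ≃ₗ[K] V', (∀ x y, B' (e x) (e y) = B x y) ∧ ∀ x, e x ∈ W' ↔ x ∈ W := by
    intro W W' hW hR hne
    have hne' := mt (isotropic_iff W W' hW hR).2 hne
    rw [ne_eq, radicalOn_eq_self_iff] at hne
    rw [radicalOn_eq_self_iff] at hne'
    push Not at hne hne'
    obtain ⟨u, hu, hy⟩ := hne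
    obtain ⟨v, hv, huv⟩ := exists_mem_apply_eq_one hy
    obtain ⟨u', hu', hy'⟩ := hne'
    obtain ⟨v', hv', huv'⟩ := exists_mem_apply_eq_one hy'
    have hU := finrank_pairCompl hB huv
    have hU' := finrank_pairCompl hB' huv'
    have hWU := finrank_comap_pairCompl hB huv hu hv
    have hWU' := finrank_comap_pairCompl hB' huv' hu' hv'
    obtain ⟨e, he, hmem⟩ := ih (finrank K (B.pairCompl u v)) (by omega) (B.pairCompl u v)
      (B'.pairCompl u' v') (B.restrict _) (B'.restrict _) (W.comap (Submodule.subtype _))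
      (W'.comap (Submodule.subtype _)) (fun x => hB x) (fun x => hB' x)
      (separatingLeft_pairCompl hB hs huv) (separatingLeft_pairCompl hB' hs' huv') rfl
      (by omega) (by omega) (by
        rw [finrank_radicalOn_comap_pairCompl hB huv hu hv,
          finrank_radicalOn_comap_pairCompl hB' huv' hu' hv', hR])
    obtain ⟨f, hf, hfe⟩ := exists_isometry_extending hB hB' huv huv' e he
    refine ⟨f, hf, fun x => ?_⟩
    obtain ⟨⟨a, b, w⟩, rfl⟩ := (hyperbolicEquiv hB huv).surjective x
    rw [hfe, hyperbolicEquiv_mem_iff hB huv hu hv, hyperbolicEquiv_mem_iff hB' huv' hu' hv']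
    exact hmem w
  by_cases hiso : B.radicalOn W = W
  swap
  · exact of_not_isotropic W W' hW hR hiso
  have hiso' := (isotropic_iff W W' hW hR).1 hiso
  rcases eq_or_ne W ⊥ with rfl | hbot
  · obtain rfl : W' = ⊥ := by
      rw [finrank_bot] at hW
      exact Submodule.finrank_eq_zero.1 hW.symm
    by_cases htop : B.radicalOn ⊤ = ⊤
    · have hsub : ∀ x : V, x = 0 := fun x =>
        hs x fun y => radicalOn_eq_self_iff.1 htop x trivial y trivial
      refine ⟨LinearEquiv.ofFinrankEq V V' (hd.trans hd'.symm), fun x y => ?_, fun x => ?_⟩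
      · simp [hsub x]
      · simp
    · obtain ⟨e, he, -⟩ := of_not_isotropic ⊤ ⊤ (by rw [finrank_top, finrank_top, hd, hd'])
        (by rw [radicalOn_top hB hs, radicalOn_top hB' hs', finrank_bot, finrank_bot]) htop
      exact ⟨e, he, fun x => by simp⟩
  · obtain ⟨u, hu, hu0⟩ := W.exists_mem_ne_zero_of_ne_bot hbot
    have hbot' : W' ≠ ⊥ := by
      rintro rfl
      rw [finrank_bot] at hW
      exact hbot (Submodule.finrank_eq_zero.1 hW)
    obtain ⟨u', hu', hu0'⟩ := W'.exists_mem_ne_zero_of_ne_bot hbot'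
    have hWiso := radicalOn_eq_self_iff.1 hiso
    have hWiso' := radicalOn_eq_self_iff.1 hiso'
    have hy : ∃ y ∈ (⊤ : Submodule K V), B u y ≠ 0 := by
      by_contra! h
      exact hu0 (hs u fun y => h y trivial)
    have hy' : ∃ y ∈ (⊤ : Submodule K V'), B' u' y ≠ 0 := by
      by_contra! h
      exact hu0' (hs' u' fun y => h y trivial)
    obtain ⟨v, -, huv⟩ := exists_mem_apply_eq_one hy
    obtain ⟨v', -, huv'⟩ := exists_mem_apply_eq_one hy'
    have hU := finrank_pairCompl hB huv
    have hU' := finrank_pairCompl hB' huv'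
    have hWU := finrank_comap_pairCompl_of_isotropic hB huv hu (hWiso u hu)
    have hWU' := finrank_comap_pairCompl_of_isotropic hB' huv' hu' (hWiso' u' hu')
    have hradU : (B.restrict (B.pairCompl u v)).radicalOn
        (W.comap (Submodule.subtype _)) = W.comap (Submodule.subtype _) :=
      radicalOn_eq_self_iff.2 fun x hx y hy => hWiso x hx y hy
    have hradU' : (B'.restrict (B'.pairCompl u' v')).radicalOn
        (W'.comap (Submodule.subtype _)) = W'.comap (Submodule.subtype _) :=
      radicalOn_eq_self_iff.2 fun x hx y hy => hWiso' x hx y hy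
    obtain ⟨e, he, hmem⟩ := ih (finrank K (B.pairCompl u v)) (by omega) (B.pairCompl u v)
      (B'.pairCompl u' v') (B.restrict _) (B'.restrict _) (W.comap (Submodule.subtype _))
      (W'.comap (Submodule.subtype _)) (fun x => hB x) (fun x => hB' x)
      (separatingLeft_pairCompl hB hs huv) (separatingLeft_pairCompl hB' hs' huv') rfl
      (by omega) (by omega) (by rw [hradU, hradU']; omega)
    obtain ⟨f, hf, hfe⟩ := exists_isometry_extending hB hB' huv huv' e he
    refine ⟨f, hf, fun x => ?_⟩
    obtain ⟨⟨a, b, w⟩, rfl⟩ := (hyperbolicEquiv hB huv).surjective x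
    rw [hfe, hyperbolicEquiv_mem_iff_of_isotropic hB huv hu (hWiso u hu),
      hyperbolicEquiv_mem_iff_of_isotropic hB' huv' hu' (hWiso' u' hu')]
    exact and_congr_right fun _ => hmem w

end LinearMap.BilinForm

end AlternatingForm

section SymplecticMatrix

open Module LinearMap

theorem isUnit_det_symJ (n : ℕ) : IsUnit (symJ n).det := by
  rw [← Matrix.isUnit_iff_isUnit_det]
  refine IsUnit.of_mul_eq_one (-symJ n) ?_
  simp [symJ, fromBlocks_multiply, fromBlocks_neg]

/-- The standard symplectic form. -/
noncomputable def symForm (n : ℕ) : LinearMap.BilinForm ℂ (Fin n ⊕ Fin n → ℂ) :=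
  Matrix.toBilin' (symJ n)

theorem symForm_apply (n : ℕ) (x y : Fin n ⊕ Fin n → ℂ) :
    symForm n x y = x ⬝ᵥ symJ n *ᵥ y :=
  Matrix.toBilin'_apply' _ _ _

theorem isAlt_symForm (n : ℕ) : (symForm n).IsAlt := by
  intro x
  simp [symForm_apply, symJ, fromBlocks_mulVec, neg_mulVec, dotProduct,
    Fintype.sum_sum_type, mul_comm]

theorem separatingLeft_symForm (n : ℕ) : (symForm n).SeparatingLeft :=
  (LinearMap.BilinForm.nondegenerate_toBilin'_of_det_ne_zero' _ (isUnit_det_symJ n).ne_zero).1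

theorem finrank_radicalOn_range {n m : ℕ} (x : Matrix (Fin n ⊕ Fin n) (Fin m) ℂ) :
    (xᵀ * symJ n * x).rank + finrank ℂ ((symForm n).radicalOn (range x.mulVecLin)) = x.rank := by
  have h := (range x.mulVecLin).finrank_map_add_finrank_inf_ker (xᵀ * symJ n).mulVecLin
  rw [← range_comp, ← mulVecLin_mul] at h
  have hR : (symForm n).radicalOn (range x.mulVecLin) =
      range x.mulVecLin ⊓ ker (xᵀ * symJ n).mulVecLin := ?_
  · rwa [hR]
  ext y
  simp only [LinearMap.BilinForm.mem_radicalOn, Submodule.mem_inf, mem_ker, mulVecLin_apply]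
  refine and_congr_right fun _ => ?_
  simp only [mem_range, forall_exists_index, forall_apply_eq_imp_iff, mulVecLin_apply,
    symForm_apply]
  rw [← dotProduct_eq_zero_iff]
  refine forall_congr' fun c => ?_
  rw [← mulVec_mulVec, dotProduct_comm, dotProduct_mulVec, mulVec_transpose]

theorem transpose_mul_symJ_mul_toMatrix' {n : ℕ}
    (e : (Fin n ⊕ Fin n → ℂ) ≃ₗ[ℂ] (Fin n ⊕ Fin n → ℂ))
    (he : ∀ x y, symForm n (e x) (e y) = symForm n x y) :
    (toMatrix' e.toLinearMap)ᵀ * symJ n * toMatrix' e.toLinearMap = symJ n := by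
  have h : (symForm n).comp e.toLinearMap e.toLinearMap = symForm n := LinearMap.ext₂ he
  have h' := congrArg LinearMap.BilinForm.toMatrix' h
  rwa [LinearMap.BilinForm.toMatrix'_comp, symForm, LinearMap.BilinForm.toMatrix'_toBilin'] at h'

end SymplecticMatrix

/-- Two `(2n)×m` complex matrices lie in the same `Sp(2n,ℂ) × GL(m,ℂ)`-orbit iff
they have the same rank and the restrictions of the symplectic form to their
column spaces have the same rank. -/
theorem symplectic_GL_orbit_iff (n m : ℕ) (hn : 0 < n) (hm : 0 < m)
    (x x' : Matrix (Fin n ⊕ Fin n) (Fin m) ℂ) :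
    (∃ (S : Matrix (Fin n ⊕ Fin n) (Fin n ⊕ Fin n) ℂ) (h : Matrix (Fin m) (Fin m) ℂ),
        Sᵀ * symJ n * S = symJ n ∧ IsUnit h ∧ x' = S * x * h) ↔
      (x.rank = x'.rank ∧ (xᵀ * symJ n * x).rank = (x'ᵀ * symJ n * x').rank) := by
  constructor
  · rintro ⟨S, h, hS, hh, rfl⟩
    have hdetS : IsUnit S.det := by
      have hJ := isUnit_det_symJ n
      rw [← hS, det_mul] at hJ
      exact isUnit_of_mul_isUnit_right hJ
    have hdet : IsUnit h.det := (isUnit_iff_isUnit_det h).1 hh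
    have hform : (S * x * h)ᵀ * symJ n * (S * x * h) = hᵀ * ((xᵀ * symJ n * x) * h) := by
      conv_rhs => rw [← hS]
      simp only [transpose_mul, Matrix.mul_assoc]
    rw [hform, rank_mul_eq_left_of_isUnit_det _ _ hdet, rank_mul_eq_right_of_isUnit_det _ _ hdetS,
      rank_mul_eq_right_of_isUnit_det _ _ (by rwa [det_transpose]),
      rank_mul_eq_left_of_isUnit_det _ _ hdet]
    exact ⟨rfl, rfl⟩
  · rintro ⟨hrank, hform⟩
    have hx := finrank_radicalOn_range x
    have hx' := finrank_radicalOn_range x'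
    obtain ⟨e, he, hmem⟩ := LinearMap.BilinForm.exists_isometry_mem_iff _ _ _ (symForm n)
      (symForm n) (LinearMap.range x.mulVecLin) (LinearMap.range x'.mulVecLin) (isAlt_symForm n)
      (isAlt_symForm n) (separatingLeft_symForm n) (separatingLeft_symForm n) rfl rfl hrank
      (by omega)
    have hrange : LinearMap.range (e.toLinearMap ∘ₗ x.mulVecLin) =
        LinearMap.range x'.mulVecLin := by
      rw [LinearMap.range_comp]
      ext y
      obtain ⟨z, rfl⟩ := e.surjective y
      rw [hmem]
      simp
    obtain ⟨g, hg⟩ := LinearMap.exists_linearEquiv_comp_eq_of_range_eq hrange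
    refine ⟨LinearMap.toMatrix' e.toLinearMap, LinearMap.toMatrix' g.toLinearMap,
      transpose_mul_symJ_mul_toMatrix' e he, ?_, ?_⟩
    · refine IsUnit.of_mul_eq_one (LinearMap.toMatrix' g.symm.toLinearMap) ?_
      rw [← LinearMap.toMatrix'_comp]
      simp
    · have h := congrArg LinearMap.toMatrix' hg
      rwa [LinearMap.toMatrix'_comp, LinearMap.toMatrix'_comp, ← Matrix.toLin'_apply',
        ← Matrix.toLin'_apply', LinearMap.toMatrix'_toLin', LinearMap.toMatrix'_toLin'] at h
end

section
/- Let n, m be positive integers, x a complex (2n)×m matrix, and y a complex m×(2n) matrix. Then the following are equivalent: (i) for every complex 2n×2n matrix ξ with ξᵀ·J + J·ξ = 0 and every complex m×m matrix η, one has trace(y·(ξ·x − x·η)) = 0; (ii) y·x = 0 and (x·y)ᵀ·J = J·(x·y). (This computes the conormal space at x to the Sp(2n,ℂ)×GL(m,ℂ)-orbit of x: y lies in it iff y·x = 0 and x·y is Ω-symmetric.) -/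
open Matrix

lemma symJ_mul_symJ (n : ℕ) : symJ n * symJ n = -1 := by
  simp [symJ, fromBlocks_multiply, ← fromBlocks_one, fromBlocks_neg]

lemma symJ_transpose (n : ℕ) : (symJ n)ᵀ = -symJ n := by
  simp [symJ, fromBlocks_transpose, fromBlocks_neg]

/-- An element of `sp(2n,ℂ)` is trace-orthogonal to every `Ω`-symmetric matrix. -/
lemma trace_mul_eq_zero_of_symplectic_of_symmetric {n : ℕ}
    {ξ A : Matrix (Fin n ⊕ Fin n) (Fin n ⊕ Fin n) ℂ}
    (hξ : ξᵀ * symJ n + symJ n * ξ = 0) (hA : Aᵀ * symJ n = symJ n * A) :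
    trace (ξ * A) = 0 := by
  have hJ := symJ_mul_symJ n
  have hξ' : ξᵀ = symJ n * ξ * symJ n := by
    have h := congrArg (· * symJ n) (eq_neg_of_add_eq_zero_left hξ)
    simpa [Matrix.mul_assoc, hJ] using h
  have hA' : Aᵀ = -(symJ n * A * symJ n) := by
    have h := congrArg (fun M => -(M * symJ n)) hA
    simpa [Matrix.mul_assoc, hJ] using h
  have h : trace (ξ * A) = -trace (ξ * A) := by
    calc trace (ξ * A) = trace (Aᵀ * ξᵀ) := by rw [← transpose_mul, trace_transpose]
      _ = trace (-(symJ n * A * (symJ n * symJ n) * ξ * symJ n)) := by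
        rw [hξ', hA']; simp only [Matrix.mul_assoc, Matrix.neg_mul]
      _ = trace (symJ n * (A * ξ * symJ n)) := by
        rw [hJ]; simp [Matrix.mul_assoc]
      _ = -trace (ξ * A) := by
        rw [trace_mul_comm, Matrix.mul_assoc, hJ, trace_mul_comm ξ]; simp
  exact self_eq_neg.mp h

/-- A matrix trace-orthogonal to `sp(2n,ℂ)` is `Ω`-symmetric. -/
lemma symmetric_of_forall_trace_mul_eq_zero {n : ℕ}
    {A : Matrix (Fin n ⊕ Fin n) (Fin n ⊕ Fin n) ℂ}
    (h : ∀ ξ : Matrix (Fin n ⊕ Fin n) (Fin n ⊕ Fin n) ℂ,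
      ξᵀ * symJ n + symJ n * ξ = 0 → trace (ξ * A) = 0) :
    Aᵀ * symJ n = symJ n * A := by
  have hJ := symJ_mul_symJ n
  have hskew : A * symJ n + (A * symJ n)ᵀ = 0 := by
    refine ext_iff_trace_mul_left.mpr fun B => ?_
    have hB := h (symJ n * (B + Bᵀ)) (by
      rw [transpose_mul, symJ_transpose, ← Matrix.mul_assoc (symJ n), hJ, Matrix.mul_assoc,
        Matrix.neg_mul, hJ]
      simp only [transpose_add, transpose_transpose, Matrix.mul_one,
        Matrix.neg_mul, Matrix.one_mul, neg_neg]
      abel)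
    rw [Matrix.mul_assoc, trace_mul_comm, Matrix.mul_assoc, Matrix.add_mul, trace_add] at hB
    rw [Matrix.mul_add, trace_add, Matrix.mul_zero, trace_zero, ← hB, ← trace_transpose (Bᵀ * _),
      transpose_mul Bᵀ, transpose_transpose, trace_mul_comm B (A * symJ n)ᵀ]
  rw [transpose_mul, symJ_transpose, Matrix.neg_mul, add_neg_eq_zero] at hskew
  have h' := congrArg (fun M => symJ n * M * symJ n) hskew
  simp only [Matrix.mul_assoc, hJ] at h'
  rw [← Matrix.mul_assoc (symJ n) (symJ n), hJ] at h'
  simpa using h'.symm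

/-- `y` lies in the conormal space at `x` to its `Sp(2n,ℂ) × GL(m,ℂ)`-orbit iff
`y·x = 0` and `x·y` is `Ω`-symmetric. -/
theorem conormal_space_characterization (n m : ℕ) (hn : 0 < n) (hm : 0 < m)
    (x : Matrix (Fin n ⊕ Fin n) (Fin m) ℂ)
    (y : Matrix (Fin m) (Fin n ⊕ Fin n) ℂ) :
    (∀ ξ : Matrix (Fin n ⊕ Fin n) (Fin n ⊕ Fin n) ℂ,
        ξᵀ * symJ n + symJ n * ξ = 0 →
      ∀ η : Matrix (Fin m) (Fin m) ℂ,
        Matrix.trace (y * (ξ * x - x * η)) = 0) ↔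
      (y * x = 0 ∧ (x * y)ᵀ * symJ n = symJ n * (x * y)) := by
  have key : ∀ ξ η, trace (y * (ξ * x - x * η)) = trace (ξ * (x * y)) - trace (y * x * η) := by
    intro ξ η
    rw [Matrix.mul_sub, trace_sub, trace_mul_comm, Matrix.mul_assoc, Matrix.mul_assoc]
  simp only [key]
  constructor
  · intro h
    constructor
    · refine ext_iff_trace_mul_right.mpr fun η => ?_
      simpa using h 0 (by simp) η
    · exact symmetric_of_forall_trace_mul_eq_zero fun ξ hξ => by simpa using h ξ hξ 0
  · rintro ⟨hyx, hxy⟩ ξ hξ η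
    rw [trace_mul_eq_zero_of_symplectic_of_symmetric hξ hxy, hyx]
    simp
end

section
/- Let p, q be positive integers and j a natural number with j ≤ min(p,q). Then the closure, in the standard topology on the space of complex p×q matrices, of the set {x : rank(x) = j} equals {x : rank(x) ≤ j}. Consequently, {x : rank x = i} is contained in the closure of {x : rank x = j} if and only if i ≤ j. -/
open Matrix

open scoped Topology

/-- Rank is lower semicontinuous: an upper bound on the rank is a closed condition. -/
theorem Matrix.isClosed_setOf_rank_le {𝕜 m n : Type*} [NontriviallyNormedField 𝕜]
    [CompleteSpace 𝕜] [Fintype m] [Fintype n] (r : ℕ) :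
    IsClosed {A : Matrix m n 𝕜 | A.rank ≤ r} := by
  classical
  let φ : Matrix m n 𝕜 →ₗ[𝕜] ((n → 𝕜) →L[𝕜] (m → 𝕜)) :=
    (LinearMap.toContinuousLinearMap.toLinearMap).comp (Matrix.toLin'.toLinearMap)
  have hφ : Continuous φ := φ.continuous_of_finiteDimensional
  have hopen := (isOpen_setOfPred_nat_le_rank (𝕜 := 𝕜) (E := n → 𝕜) (F := m → 𝕜)
    (r + 1)).preimage hφ
  rw [← isOpen_compl_iff]
  convert hopen using 1
  ext A
  have hrank : ((φ A : (n → 𝕜) →L[𝕜] (m → 𝕜)) : (n → 𝕜) →ₗ[𝕜] (m → 𝕜)).rank = A.rank :=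
    (Module.finrank_eq_rank 𝕜 (LinearMap.range A.mulVecLin)).symm
  simp only [Set.mem_compl_iff, Set.mem_ofPred_eq, Set.mem_preimage, hrank, Nat.cast_le]
  omega

/-- Rank is subadditive. -/
theorem Matrix.rank_add_le {K m n : Type*} [Field K] [Fintype m] [Fintype n]
    (A B : Matrix m n K) : (A + B).rank ≤ A.rank + B.rank := by
  rw [Matrix.rank, mulVecLin_add]
  exact (Submodule.finrank_mono (LinearMap.range_add_le _ _)).trans
    (Submodule.finrank_add_le_finrank_add_finrank _ _)

/-- Adding `vecMulVec w u` raises the rank by one if `w` is outside the range of `A` and `u` does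
not annihilate the kernel of `A`. -/
theorem Matrix.rank_add_vecMulVec {K m n : Type*} [Field K] [Fintype m] [Fintype n]
    (A : Matrix m n K) {w : m → K} {u v : n → K} (hw : w ∉ LinearMap.range A.mulVecLin)
    (hv : A *ᵥ v = 0) (huv : u ⬝ᵥ v ≠ 0) :
    (A + vecMulVec w u).rank = A.rank + 1 := by
  have hmul (x : n → K) : (A + vecMulVec w u) *ᵥ x = A *ᵥ x + (u ⬝ᵥ x) • w := by
    rw [add_mulVec, vecMulVec_mulVec, op_smul_eq_smul]
  apply le_antisymm
  · exact (rank_add_le _ _).trans (Nat.add_le_add_left (rank_vecMulVec_le w u) _)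
  · have hmem : w ∈ LinearMap.range (A + vecMulVec w u).mulVecLin :=
      ⟨(u ⬝ᵥ v)⁻¹ • v, by
        rw [mulVecLin_apply, mulVec_smul, hmul, hv, zero_add, inv_smul_smul₀ huv]⟩
    apply Submodule.finrank_lt_finrank_of_lt
    refine lt_of_le_of_ne ?_ fun h => hw (h ▸ hmem)
    rintro _ ⟨x, rfl⟩
    have hx : A *ᵥ x = (A + vecMulVec w u) *ᵥ x - (u ⬝ᵥ x) • w := by
      rw [hmul, add_sub_cancel_right]
    rw [mulVecLin_apply, hx]
    exact sub_mem ⟨x, rfl⟩ (Submodule.smul_mem _ _ hmem)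

/-- A matrix of non-maximal rank is a limit of matrices whose rank is larger by one. -/
theorem Matrix.mem_closure_setOf_rank_eq_succ {𝕜 m n : Type*} [NontriviallyNormedField 𝕜]
    [Fintype m] [Fintype n] (A : Matrix m n 𝕜) (hm : A.rank < Fintype.card m)
    (hn : A.rank < Fintype.card n) :
    A ∈ closure {B : Matrix m n 𝕜 | B.rank = A.rank + 1} := by
  classical
  obtain ⟨w, hw⟩ : ∃ w, w ∉ LinearMap.range A.mulVecLin := by
    by_contra! h
    have htop := (Submodule.eq_top_iff').2 h
    rw [Matrix.rank, htop, finrank_top, Module.finrank_fintype_fun_eq_card] at hm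
    exact lt_irrefl _ hm
  obtain ⟨v, hv, hv0⟩ : ∃ v, A *ᵥ v = 0 ∧ v ≠ 0 := by
    by_contra! h
    have hker : LinearMap.ker A.mulVecLin = ⊥ := (Submodule.eq_bot_iff _).2 h
    rw [Matrix.rank, LinearMap.finrank_range_of_inj (LinearMap.ker_eq_bot.1 hker),
      Module.finrank_fintype_fun_eq_card] at hn
    exact lt_irrefl _ hn
  obtain ⟨k, hk⟩ := Function.ne_iff.1 hv0
  have hlim : Filter.Tendsto (fun t : 𝕜 => A + vecMulVec w (t • Pi.single k 1)) (𝓝[≠] 0) (𝓝 A) := by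
    have hc : Continuous fun t : 𝕜 => A + t • vecMulVec w (Pi.single k 1) := by fun_prop
    simpa [vecMulVec_smul] using (hc.tendsto 0).mono_left nhdsWithin_le_nhds
  refine mem_closure_of_tendsto hlim ?_
  filter_upwards [self_mem_nhdsWithin] with t ht
  refine A.rank_add_vecMulVec hw hv ?_
  rw [smul_dotProduct, single_one_dotProduct]
  exact mul_ne_zero ht hk

/-- The closure of the set of matrices of rank `r` is the set of matrices of rank at most `r`. -/
theorem Matrix.closure_setOf_rank_eq {𝕜 m n : Type*} [NontriviallyNormedField 𝕜]
    [CompleteSpace 𝕜] [Fintype m] [Fintype n] {r : ℕ} (hm : r ≤ Fintype.card m)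
    (hn : r ≤ Fintype.card n) :
    closure {A : Matrix m n 𝕜 | A.rank = r} = {A : Matrix m n 𝕜 | A.rank ≤ r} := by
  refine (closure_minimal (fun A hA => le_of_eq hA) (isClosed_setOf_rank_le r)).antisymm ?_
  induction r with
  | zero => exact fun A hA => subset_closure (Nat.le_zero.1 hA)
  | succ r ih =>
    intro A hA
    obtain hlt | heq := Nat.lt_or_eq_of_le hA
    · refine closure_minimal ?_ isClosed_closure
        (ih (by omega) (by omega) (Nat.lt_succ_iff.1 hlt))
      rintro B rfl
      exact B.mem_closure_setOf_rank_eq_succ hm hn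
    · exact subset_closure heq

/-- The closure of the rank-`j` stratum of complex `p×q` matrices is the set of
matrices of rank at most `j`; consequently the rank strata are ordered by rank. -/
theorem closure_rank_stratum (p q : ℕ) (hp : 0 < p) (hq : 0 < q)
    (j : ℕ) (hj : j ≤ min p q) (i : ℕ) (hi : i ≤ min p q) :
    closure {x : Matrix (Fin p) (Fin q) ℂ | x.rank = j} =
      {x : Matrix (Fin p) (Fin q) ℂ | x.rank ≤ j} ∧
    ({x : Matrix (Fin p) (Fin q) ℂ | x.rank = i} ⊆
        closure {x : Matrix (Fin p) (Fin q) ℂ | x.rank = j} ↔ i ≤ j) := by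
  have hclosure {r : ℕ} (hr : r ≤ min p q) :
      closure {x : Matrix (Fin p) (Fin q) ℂ | x.rank = r} = {x | x.rank ≤ r} :=
    closure_setOf_rank_eq (by simp; omega) (by simp; omega)
  refine ⟨hclosure hj, ?_⟩
  rw [hclosure hj]
  refine ⟨fun h => ?_, fun h x hx => le_of_eq_of_le hx h⟩
  have hzero : (0 : Matrix (Fin p) (Fin q) ℂ) ∈ closure {x | x.rank = i} := by
    simp [hclosure hi]
  obtain ⟨x, hx⟩ := closure_nonempty_iff.1 ⟨0, hzero⟩
  exact le_of_eq_of_le (Eq.symm hx) (h hx)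
end

section
/- Let n ≥ 1 and let (x₁,x₂) and (x₁',x₂') be pairs of vectors in ℂ^{2n} with Ω(x₁,x₂) ≠ 0 and Ω(x₁',x₂') ≠ 0. Then there exist S in the symplectic group Sp(2n,ℂ) and nonzero scalars s, t ∈ ℂ with x₁' = s·(S·x₁) and x₂' = t·(S·x₂). (The set Y of pairs with nonzero symplectic product is a single orbit of ℂˣ×Sp(2n,ℂ)×ℂˣ on ℂ^{2n} ⊕ ℂ^{2n}.) -/
open Matrix

namespace LinearMap.BilinForm

variable {K V : Type*} [Field K] [AddCommGroup V] [Module K V] {B : LinearMap.BilinForm K V}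

/-- A symplectic transvection along `y - x` is an isometry that moves `x` to `y` whenever
`B x y ≠ 0`, and it fixes every vector orthogonal to `y - x`. -/
theorem IsAlt.exists_isometry_of_apply_ne_zero (hB : B.IsAlt) {x y : V} (hxy : B x y ≠ 0) :
    ∃ f : V →ₗ[K] V, (∀ v w, B (f v) (f w) = B v w) ∧ f x = y ∧
      ∀ v, B v x = B v y → f v = v := by
  have hneg : ∀ v w, B v w = -B w v := fun v w => (hB.neg_eq w v).symm
  refine ⟨LinearMap.id - (B x y)⁻¹ • (B (y - x)).smulRight (y - x), fun v w => ?_, ?_,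
    fun v hv => ?_⟩
  · have huu : B (y - x) (y - x) = 0 := hB _
    have hvu := hneg v (y - x)
    generalize y - x = u at *
    simp only [LinearMap.sub_apply, LinearMap.id_apply, LinearMap.smul_apply,
      LinearMap.smulRight_apply, map_sub, map_smul, smul_eq_mul, huu, hvu]
    ring
  · have hyx : B (y - x) x = -B x y := by
      simp [hneg y x, show B x x = 0 from hB x]
    simp only [LinearMap.sub_apply, LinearMap.id_apply, LinearMap.smul_apply,
      LinearMap.smulRight_apply, hyx, smul_smul, neg_smul, smul_neg,
      inv_mul_cancel₀ hxy]
    simp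
  · have hv' : B (y - x) v = 0 := by
      rw [hneg, map_sub, hv, sub_self, neg_zero]
    simp only [LinearMap.sub_apply, LinearMap.id_apply, LinearMap.smul_apply,
      LinearMap.smulRight_apply, hv', zero_smul, smul_zero, sub_zero]

/-- Isometries of an alternating form act transitively on pairs with a prescribed nonzero
value of the form. -/
theorem IsAlt.exists_isometry_of_apply_eq (hB : B.IsAlt) {x₁ x₂ y₁ y₂ : V} (hx : B x₁ x₂ ≠ 0)
    (hxy : B x₁ x₂ = B y₁ y₂) :
    ∃ f : V →ₗ[K] V, (∀ v w, B (f v) (f w) = B v w) ∧ f x₁ = y₁ ∧ f x₂ = y₂ := by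
  have hneg : ∀ v w, B v w = -B w v := fun v w => (hB.neg_eq w v).symm
  have hy : B y₁ y₂ ≠ 0 := hxy ▸ hx
  obtain ⟨z, hxz, hzy⟩ : ∃ z, B x₁ z ≠ 0 ∧ B z y₁ ≠ 0 := by
    by_cases h₁ : B x₂ y₁ = 0
    · by_cases h₂ : B x₁ y₂ = 0
      · refine ⟨x₂ + y₂, by simpa [h₂] using hx, ?_⟩
        simpa [h₁, hneg y₂ y₁] using hy
      · exact ⟨y₂, h₂, by simpa [hneg y₂ y₁] using hy⟩
    · exact ⟨x₂, hx, h₁⟩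
  obtain ⟨f, hf, hfx, -⟩ := hB.exists_isometry_of_apply_ne_zero hxz
  obtain ⟨g, hg, hgz, -⟩ := hB.exists_isometry_of_apply_ne_zero hzy
  have hgf : B y₁ (g (f x₂)) = B y₁ y₂ := by rw [← hgz, ← hfx, hg, hf, hxy, hfx, hgz]
  suffices ∀ w, B y₁ w = B y₁ y₂ →
      ∃ h : V →ₗ[K] V, (∀ v w, B (h v) (h w) = B v w) ∧ h y₁ = y₁ ∧ h w = y₂ by
    obtain ⟨h, hh, hhy, hhw⟩ := this _ hgf
    exact ⟨h ∘ₗ g ∘ₗ f, by simp [hh, hg, hf], by simp [hfx, hgz, hhy], by simp [hhw]⟩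
  intro w hw
  have hself : B y₁ y₁ = 0 := hB y₁
  by_cases hwy : B w y₂ = 0
  · obtain ⟨h, hh, hhw, hhfix⟩ := hB.exists_isometry_of_apply_ne_zero
      (x := w) (y := w + y₁) (by
        rw [map_add, show B w w = 0 from hB w, zero_add, hneg, hw]
        exact neg_ne_zero.mpr hy)
    obtain ⟨k, hk, hkw, hkfix⟩ := hB.exists_isometry_of_apply_ne_zero
      (x := w + y₁) (y := y₂) (by simpa [hwy] using hy)
    refine ⟨k ∘ₗ h, by simp [hk, hh], ?_, by simp [hhw, hkw]⟩
    rw [LinearMap.comp_apply, hhfix _ (by simp [hself]), hkfix _ (by simp [hself, hw])]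
  · obtain ⟨h, hh, hhw, hhfix⟩ := hB.exists_isometry_of_apply_ne_zero hwy
    exact ⟨h, hh, hhfix _ hw, hhw⟩

end LinearMap.BilinForm

theorem isAlt_toBilin'_symJ (n : ℕ) : (Matrix.toBilin' (symJ n)).IsAlt := by
  intro v
  rw [Matrix.toBilin'_apply', symJ, fromBlocks_mulVec]
  simp [neg_mulVec, dotProduct, Fintype.sum_sum_type, mul_comm]

/-- Pairs of vectors with nonzero symplectic product form a single orbit of
`ℂˣ × Sp(2n,ℂ) × ℂˣ` on `ℂ^{2n} ⊕ ℂ^{2n}`. -/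
theorem symplectic_transitive_nondegenerate_pairs (n : ℕ) (hn : 1 ≤ n)
    (x₁ x₂ x₁' x₂' : (Fin n ⊕ Fin n) → ℂ)
    (hΩ : x₁ ⬝ᵥ (symJ n).mulVec x₂ ≠ 0) (hΩ' : x₁' ⬝ᵥ (symJ n).mulVec x₂' ≠ 0) :
    ∃ (S : Matrix (Fin n ⊕ Fin n) (Fin n ⊕ Fin n) ℂ) (s t : ℂ),
      Sᵀ * symJ n * S = symJ n ∧ s ≠ 0 ∧ t ≠ 0 ∧
      x₁' = s • S.mulVec x₁ ∧ x₂' = t • S.mulVec x₂ := by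
  rw [← Matrix.toBilin'_apply'] at hΩ hΩ'
  set B := Matrix.toBilin' (symJ n) with hB
  set t := B x₁' x₂' / B x₁ x₂ with ht
  have ht0 : t ≠ 0 := div_ne_zero hΩ' hΩ
  obtain ⟨f, hf, hf₁, hf₂⟩ := (isAlt_toBilin'_symJ n).exists_isometry_of_apply_eq
    (y₁ := x₁') (y₂ := t⁻¹ • x₂') hΩ (by
      rw [← hB, map_smul, smul_eq_mul, ht]
      field_simp)
  refine ⟨LinearMap.toMatrix' f, 1, t, ?_, one_ne_zero, ht0, ?_, ?_⟩
  · apply Matrix.toBilin'.injective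
    rw [← Matrix.toBilin'_comp, Matrix.toLin'_toMatrix']
    exact LinearMap.ext₂ hf
  · rw [LinearMap.toMatrix'_mulVec, hf₁, one_smul]
  · rw [LinearMap.toMatrix'_mulVec, hf₂, smul_inv_smul₀ ht0]
end

section
/- Let n ≥ 2 and i ≥ 1, and let x, x' be complex skew-symmetric n×n matrices with rank(x) = rank(x') = 2i. Let y be a nonzero vector in the column space of x and y' a nonzero vector in the column space of x'. Then there exist an invertible complex n×n matrix g and a nonzero scalar t ∈ ℂ such that x' = g·x·gᵀ and y' = t·(g·y). (The set Z_i = {(x,y) : x skew-symmetric of rank 2i, y ≠ 0, y ⊥ ker x} is a single orbit of GL(n,ℂ)×ℂˣ on ∧²ℂⁿ ⊕ ℂⁿ.) -/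
open Matrix

open Module

section AlternatingForms

variable {K : Type*} [Field K]

/-- A hyperbolic pair `w, v` of an alternating form splits off: the ambient space is the direct
sum of the plane spanned by `w, v` and its orthogonal complement `W`, which contains the radical. -/
theorem LinearMap.IsAlt.exists_hyperbolic_decomposition {V : Type*} [AddCommGroup V] [Module K V]
    {B : V →ₗ[K] V →ₗ[K] K} (hB : B.IsAlt) {w v : V} (hwv : B w v = 1) :
    ∃ (W : Submodule K V) (E : ((K × K) × W) ≃ₗ[K] V),
      (∀ p, E p = p.1.1 • w + p.1.2 • v + (p.2 : V)) ∧
      (∀ p q, B (E p) (E q) =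
        p.1.1 * q.1.2 - p.1.2 * q.1.1 + B.domRestrict₁₂ W W p.2 q.2) ∧
      finrank K (LinearMap.ker (B.domRestrict₁₂ W W)) = finrank K (LinearMap.ker B) := by
  have hww : B w w = 0 := hB w
  have hvv : B v v = 0 := hB v
  have hvw : B v w = -1 := by rw [← hB.neg w v, hwv]
  let W : Submodule K V := LinearMap.ker (B w) ⊓ LinearMap.ker (B v)
  have hW (z : W) : B w z = 0 ∧ B v z = 0 := z.2
  have hW' (z : W) : B z w = 0 ∧ B z v = 0 := by
    rw [← hB.neg w z, ← hB.neg v z, (hW z).1, (hW z).2]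
    simp
  let F : ((K × K) × W) →ₗ[K] V :=
    ((LinearMap.toSpanSingleton K V w).coprod (LinearMap.toSpanSingleton K V v)).coprod W.subtype
  have hF (p) : F p = p.1.1 • w + p.1.2 • v + (p.2 : V) := by
    simp [F]
  have hF_bij : Function.Bijective F := by
    constructor
    · rw [← LinearMap.ker_eq_bot, LinearMap.ker_eq_bot']
      rintro ⟨⟨a, b⟩, z⟩ h
      rw [hF] at h
      have h₁ := congrArg (B w) h
      have h₂ := congrArg (B v) h
      simp [hww, hvv, hvw, hwv, hW z] at h₁ h₂
      subst h₁ h₂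
      simpa using h
    · intro u
      refine ⟨((-B v u, B w u), ⟨u + B v u • w - B w u • v, ?_⟩), ?_⟩
      · simp [W, hww, hvv, hvw, hwv]
      · rw [hF]
        simp
  refine ⟨W, LinearEquiv.ofBijective F hF_bij, hF, ?_, ?_⟩
  · intro p q
    simp only [LinearEquiv.ofBijective_apply, hF]
    change _ = _ + B p.2 q.2
    simp [hww, hvv, hvw, hwv, hW, hW']
    ring
  · have hle : LinearMap.ker B ≤ W := by
      intro u hu
      have hu' : B u = 0 := hu
      constructor
      · simp [← hB.neg u w, hu']
      · simp [← hB.neg u v, hu']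
    have hker : LinearMap.ker (B.domRestrict₁₂ W W) = (LinearMap.ker B).comap W.subtype := by
      ext z
      simp only [LinearMap.mem_ker, Submodule.mem_comap, Submodule.subtype_apply]
      constructor
      · intro h
        ext u
        obtain ⟨q, rfl⟩ := hF_bij.2 u
        have h₁ : B z q.2 = 0 := LinearMap.congr_fun h q.2
        simp [hF, hW' z, h₁]
      · intro h
        ext q
        exact LinearMap.congr_fun h q
    rw [hker]
    exact (Submodule.comapSubtypeEquivOfLe hle).finrank_eq

/-- Two alternating forms on spaces of the same finite dimension, with radicals of the same
dimension, are isometric by an isometry carrying a given vector outside the first radical to a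
given vector outside the second. -/
theorem LinearMap.IsAlt.exists_isometry_apply_eq {V V' : Type*}
    [AddCommGroup V] [Module K V] [FiniteDimensional K V]
    [AddCommGroup V'] [Module K V'] [FiniteDimensional K V']
    {B : V →ₗ[K] V →ₗ[K] K} {B' : V' →ₗ[K] V' →ₗ[K] K} (hB : B.IsAlt) (hB' : B'.IsAlt)
    (hdim : finrank K V = finrank K V')
    (hker : finrank K (LinearMap.ker B) = finrank K (LinearMap.ker B'))
    {w : V} {w' : V'} (hw : B w ≠ 0) (hw' : B' w' ≠ 0) :
    ∃ e : V ≃ₗ[K] V', (∀ u v, B' (e u) (e v) = B u v) ∧ e w = w' := by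
  induction hd : finrank K V using Nat.strong_induction_on generalizing V V' with
  | _ d ih =>
  obtain ⟨v, hv⟩ := LinearMap.surjective hw 1
  obtain ⟨v', hv'⟩ := LinearMap.surjective hw' 1
  obtain ⟨W, E, hE, hBE, hWker⟩ := hB.exists_hyperbolic_decomposition hv
  obtain ⟨W', E', hE', hBE', hWker'⟩ := hB'.exists_hyperbolic_decomposition hv'
  have hEdim := E.finrank_eq
  have hEdim' := E'.finrank_eq
  simp only [finrank_prod, finrank_self] at hEdim hEdim'
  have hWdim : finrank K W = finrank K W' := by omega
  have hkers : finrank K (LinearMap.ker (B.domRestrict₁₂ W W)) =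
      finrank K (LinearMap.ker (B'.domRestrict₁₂ W' W')) := by rw [hWker, hWker', hker]
  obtain ⟨f, hf⟩ : ∃ f : W ≃ₗ[K] W', ∀ z₁ z₂,
      B'.domRestrict₁₂ W' W' (f z₁) (f z₂) = B.domRestrict₁₂ W W z₁ z₂ := by
    by_cases h : B.domRestrict₁₂ W W = 0
    · have h' : B'.domRestrict₁₂ W' W' = 0 := by
        rw [← LinearMap.ker_eq_top]
        apply Submodule.eq_top_of_finrank_eq
        rw [← hkers, ← hWdim, h, LinearMap.ker_zero, finrank_top]
      exact ⟨LinearEquiv.ofFinrankEq W W' hWdim, by simp [h, h']⟩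
    · have h' : B'.domRestrict₁₂ W' W' ≠ 0 := by
        intro h'
        apply h
        rw [← LinearMap.ker_eq_top]
        apply Submodule.eq_top_of_finrank_eq
        rw [hkers, hWdim, h', LinearMap.ker_zero, finrank_top]
      obtain ⟨z, hz⟩ := DFunLike.ne_iff.mp h
      obtain ⟨z', hz'⟩ := DFunLike.ne_iff.mp h'
      obtain ⟨f, hf, -⟩ := ih (finrank K W) (by omega) (B := B.domRestrict₁₂ W W)
        (B' := B'.domRestrict₁₂ W' W') (fun z => hB z) (fun z => hB' z) hWdim hkers hz hz' rfl
      exact ⟨f, hf⟩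
  refine ⟨E.symm ≪≫ₗ (LinearEquiv.refl K (K × K)).prodCongr f ≪≫ₗ E', ?_, ?_⟩
  · intro u₁ u₂
    obtain ⟨p, rfl⟩ := E.surjective u₁
    obtain ⟨q, rfl⟩ := E.surjective u₂
    simp only [LinearEquiv.trans_apply, LinearEquiv.symm_apply_apply, hBE, hBE']
    simp only [LinearEquiv.prodCongr_apply, LinearEquiv.refl_apply, hf]
  · have hw_eq : w = E ((1, 0), 0) := by simp [hE]
    rw [hw_eq]
    simp [hE']

end AlternatingForms

section SkewMatrices

variable {K m : Type*} [Field K] [Fintype m] [DecidableEq m] {x : Matrix m m K}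

theorem Matrix.isAlt_toBilin'_of_transpose_eq_neg [NeZero (2 : K)] (hx : xᵀ = -x) :
    LinearMap.IsAlt (Matrix.toBilin' x) := by
  intro u
  have h : u ⬝ᵥ x *ᵥ u = -(u ⬝ᵥ x *ᵥ u) := by
    conv_lhs => rw [dotProduct_comm, ← vecMul_transpose, ← dotProduct_mulVec, hx]
    simp [neg_mulVec]
  rw [Matrix.toBilin'_apply']
  have h₂ : (2 : K) * (u ⬝ᵥ x *ᵥ u) = 0 := by linear_combination h
  exact (mul_eq_zero.mp h₂).resolve_left two_ne_zero

theorem Matrix.toBilin'_apply_eq_zero_iff_of_transpose_eq_neg (hx : xᵀ = -x) (u : m → K) :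
    Matrix.toBilin' x u = 0 ↔ x *ᵥ u = 0 := by
  have h (v : m → K) : Matrix.toBilin' x u v = -((x *ᵥ u) ⬝ᵥ v) := by
    rw [Matrix.toBilin'_apply', dotProduct_mulVec, ← mulVec_transpose, hx, neg_mulVec,
      neg_dotProduct]
  constructor
  · intro hu
    apply dotProduct_eq_zero
    intro v
    have := h v
    rw [hu] at this
    simpa using this
  · intro hu
    apply LinearMap.ext
    intro v
    simp [h, hu]

theorem Matrix.finrank_ker_toBilin'_of_transpose_eq_neg (hx : xᵀ = -x) :
    x.rank + finrank K (LinearMap.ker (Matrix.toBilin' x)) = Fintype.card m := by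
  have hker : LinearMap.ker (Matrix.toBilin' x) = LinearMap.ker x.mulVecLin := by
    ext u
    exact Matrix.toBilin'_apply_eq_zero_iff_of_transpose_eq_neg hx u
  rw [hker, Matrix.rank, LinearMap.finrank_range_add_finrank_ker, finrank_fintype_fun_eq_card]

end SkewMatrices

/-- The set `Z_i` of pairs `(x, y)` with `x` skew-symmetric of rank `2i` and
`y` a nonzero vector in the column space of `x` is a single orbit of
`GL(n,ℂ) × ℂˣ` on `∧²ℂⁿ ⊕ ℂⁿ`. -/
theorem skew_pair_orbit (n i : ℕ) (hn : 2 ≤ n) (hi : 1 ≤ i)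
    (x x' : Matrix (Fin n) (Fin n) ℂ) (hx : xᵀ = -x) (hx' : x'ᵀ = -x')
    (hrx : x.rank = 2 * i) (hrx' : x'.rank = 2 * i)
    (y y' : Fin n → ℂ) (hy : y ≠ 0) (hy' : y' ≠ 0)
    (hyx : y ∈ LinearMap.range x.mulVecLin)
    (hyx' : y' ∈ LinearMap.range x'.mulVecLin) :
    ∃ (g : Matrix (Fin n) (Fin n) ℂ) (t : ℂ),
      IsUnit g ∧ t ≠ 0 ∧ x' = g * x * gᵀ ∧ y' = t • g.mulVec y := by
  obtain ⟨w, rfl⟩ := hyx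
  obtain ⟨w', rfl⟩ := hyx'
  have hr := Matrix.finrank_ker_toBilin'_of_transpose_eq_neg hx
  have hr' := Matrix.finrank_ker_toBilin'_of_transpose_eq_neg hx'
  obtain ⟨e, he, hew⟩ := LinearMap.IsAlt.exists_isometry_apply_eq
    (Matrix.isAlt_toBilin'_of_transpose_eq_neg hx')
    (Matrix.isAlt_toBilin'_of_transpose_eq_neg hx) rfl (by omega)
    (mt (Matrix.toBilin'_apply_eq_zero_iff_of_transpose_eq_neg hx' w').mp hy')
    (mt (Matrix.toBilin'_apply_eq_zero_iff_of_transpose_eq_neg hx w).mp hy)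
  have hmul (u) : LinearMap.toMatrix' e.toLinearMap *ᵥ u = e u :=
    LinearMap.toMatrix'_mulVec e.toLinearMap u
  have hxx' : x' =
      (LinearMap.toMatrix' e.toLinearMap)ᵀ * x * LinearMap.toMatrix' e.toLinearMap := by
    apply Matrix.toBilin'.injective
    apply LinearMap.ext₂
    intro u v
    rw [← he u v, Matrix.toBilin'_apply', Matrix.toBilin'_apply', ← mulVec_mulVec,
      ← mulVec_mulVec, hmul, dotProduct_mulVec u, vecMul_transpose, hmul]
  refine ⟨(LinearMap.toMatrix' e.toLinearMap)ᵀ, 1, ?_, one_ne_zero, ?_, ?_⟩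
  · rw [Matrix.isUnit_iff_isUnit_det, det_transpose, LinearMap.det_toMatrix']
    exact LinearEquiv.isUnit_det' e
  · rwa [transpose_transpose]
  · rw [one_smul, mulVecLin_apply, mulVecLin_apply, ← hew, ← hmul w', mulVec_mulVec, mulVec_mulVec,
      ← hxx']
end

section
/- Let n ≥ 2 and i ≥ 1. Let x₀ be a complex skew-symmetric n×n matrix of rank 2i, and let y₀ be a nonzero vector in the column space of x₀ (regarded as a column vector). Suppose x' is a complex skew-symmetric n×n matrix and y' ∈ ℂⁿ is a row vector such that 2·x₀·x' + y₀·y' = 0 (an identity of n×n matrices, where y₀·y' is the outer product with entries (y₀)ⱼ·(y')ₖ). Then rank(x') ≤ n − 2i + 1. -/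
open Matrix

/-- Sylvester's rank inequality. -/
theorem Matrix.rank_add_rank_le_card_add_rank_mul {K l m n : Type*} [Field K]
    [Fintype l] [Fintype m] [Fintype n] (A : Matrix l m K) (B : Matrix m n K) :
    A.rank + B.rank ≤ Fintype.card m + (A * B).rank := by
  have hA := A.mulVecLin.finrank_range_add_finrank_ker
  have hB := (A.mulVecLin.domRestrict (LinearMap.range B.mulVecLin)).finrank_range_add_finrank_ker
  have hrange : LinearMap.range (A.mulVecLin.domRestrict (LinearMap.range B.mulVecLin)) =
      LinearMap.range (A * B).mulVecLin := by
    rw [Matrix.mulVecLin_mul, LinearMap.range_comp, LinearMap.range_domRestrict]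
  have hker : Module.finrank K
      (LinearMap.ker (A.mulVecLin.domRestrict (LinearMap.range B.mulVecLin))) ≤
      Module.finrank K (LinearMap.ker A.mulVecLin) := by
    rw [LinearMap.ker_domRestrict, ← Submodule.finrank_map_subtype_eq]
    exact Submodule.finrank_mono (Submodule.map_comap_le _ _)
  rw [hrange] at hB
  rw [Module.finrank_fintype_fun_eq_card] at hA
  unfold Matrix.rank
  omega

/-- Rank bound for elements of the conormal space at `(x₀, y₀)` to the orbit
`Z_i ⊆ ∧²ℂⁿ ⊕ ℂⁿ`. -/
theorem conormal_rank_bound_skew (n i : ℕ) (hn : 2 ≤ n) (hi : 1 ≤ i)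
    (x₀ : Matrix (Fin n) (Fin n) ℂ) (hx₀ : x₀ᵀ = -x₀) (hrx₀ : x₀.rank = 2 * i)
    (y₀ : Fin n → ℂ) (hy₀ : y₀ ≠ 0) (hy₀x : y₀ ∈ LinearMap.range x₀.mulVecLin)
    (x' : Matrix (Fin n) (Fin n) ℂ) (hx' : x'ᵀ = -x') (y' : Fin n → ℂ)
    (heq : (2 : ℂ) • (x₀ * x') + Matrix.vecMulVec y₀ y' = 0) :
    x'.rank ≤ n - 2 * i + 1 := by
  have hprod : x₀ * x' = Matrix.vecMulVec ((-(1 / 2) : ℂ) • y₀) y' := by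
    rw [Matrix.smul_vecMulVec, eq_neg_of_add_eq_zero_right heq, smul_neg, smul_smul, ← neg_smul]
    norm_num
  have hrank : (x₀ * x').rank ≤ 1 := hprod ▸ Matrix.rank_vecMulVec_le _ _
  have hsylvester := Matrix.rank_add_rank_le_card_add_rank_mul x₀ x'
  rw [Fintype.card_fin] at hsylvester
  omega
end

section
/- Let p, q, i be positive integers with i ≤ min(p,q). Let x, x' be complex q×p matrices with rank(x) = rank(x') = i, and let y, y' be nonzero row vectors of length p such that y lies in the row space of x and y' lies in the row space of x'. Then there exist invertible matrices g ∈ GL(q,ℂ) and h ∈ GL(p,ℂ) such that x' = g·x·h⁻¹ and y' = y·h⁻¹. (The set Z_i = {(x,y) : rank x = i, y ≠ 0, y ⊥ ker x} is a single orbit of GL(q,ℂ)×GL(p,ℂ) on Hom(ℂᵖ,ℂq) ⊕ ℂ^{p*}.) -/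
open Matrix

/-- Two surjections onto the same space from spaces of equal finite dimension differ by a linear
equivalence of their sources. -/
theorem LinearMap.exists_linearEquiv_comp_eq {K V V' U : Type*} [Field K] [AddCommGroup V]
    [Module K V] [FiniteDimensional K V] [AddCommGroup V'] [Module K V'] [FiniteDimensional K V']
    [AddCommGroup U] [Module K U] (a : V →ₗ[K] U) (b : V' →ₗ[K] U)
    (ha : Function.Surjective a) (hb : Function.Surjective b)
    (hdim : Module.finrank K V = Module.finrank K V') :
    ∃ e : V ≃ₗ[K] V', ∀ v, b (e v) = a v := by
  obtain ⟨C, hC⟩ := (LinearMap.ker a).exists_isCompl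
  obtain ⟨C', hC'⟩ := (LinearMap.ker b).exists_isCompl
  have hker : Module.finrank K (LinearMap.ker a) = Module.finrank K (LinearMap.ker b) := by
    have h₁ := a.finrank_range_add_finrank_ker
    have h₂ := b.finrank_range_add_finrank_ker
    rw [LinearMap.range_eq_top.2 ha] at h₁
    rw [LinearMap.range_eq_top.2 hb] at h₂
    omega
  let k := LinearEquiv.ofFinrankEq _ _ hker
  let A := LinearMap.equivProdOfSurjectiveOfIsCompl a ((LinearMap.ker a).projectionOnto C hC)
    (LinearMap.range_eq_top.2 ha) (by simp) (by simpa using hC)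
  let B := LinearMap.equivProdOfSurjectiveOfIsCompl b ((LinearMap.ker b).projectionOnto C' hC')
    (LinearMap.range_eq_top.2 hb) (by simp) (by simpa using hC')
  refine ⟨A.trans (((LinearEquiv.refl K U).prodCongr k).trans B.symm), fun v => ?_⟩
  have hB : ∀ w, (B w).1 = b w := fun w => rfl
  rw [← hB]
  simp [A]

/-- Pairs `(x, φ ∘ x)` with `x` of fixed rank and `φ ∘ x ≠ 0` are equivalent under automorphisms
of the source and target. -/
theorem LinearMap.exists_linearEquiv_intertwining {K V W : Type*} [Field K] [AddCommGroup V]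
    [Module K V] [FiniteDimensional K V] [AddCommGroup W] [Module K W]
    (x x' : V →ₗ[K] W) (φ φ' : Module.Dual K W)
    (hrank : Module.finrank K (LinearMap.range x) = Module.finrank K (LinearMap.range x'))
    (hφ : φ ∘ₗ x ≠ 0) (hφ' : φ' ∘ₗ x' ≠ 0) :
    ∃ (g : W ≃ₗ[K] W) (h : V ≃ₗ[K] V),
      (∀ v, x' (h v) = g (x v)) ∧ ∀ v, φ' (x' (h v)) = φ (x v) := by
  have hsurj : ∀ (z : V →ₗ[K] W) (ψ : Module.Dual K W), ψ ∘ₗ z ≠ 0 →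
      Function.Surjective (ψ ∘ₗ (LinearMap.range z).subtype) := by
    intro z ψ hψ
    refine LinearMap.surjective fun h0 => hψ ?_
    ext v
    exact LinearMap.congr_fun h0 ⟨z v, v, rfl⟩
  obtain ⟨e, he⟩ := LinearMap.exists_linearEquiv_comp_eq _ _ (hsurj x φ hφ) (hsurj x' φ' hφ') hrank
  obtain ⟨g, hg⟩ := Submodule.exists_linearEquiv_restrict_eq e
  obtain ⟨h, hh⟩ := LinearMap.exists_linearEquiv_comp_eq (e.toLinearMap ∘ₗ x.rangeRestrict)
    x'.rangeRestrict (e.surjective.comp x.surjective_rangeRestrict) x'.surjective_rangeRestrict rfl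
  have hx : ∀ v, x' (h v) = e (x.rangeRestrict v) := fun v => congrArg Subtype.val (hh v)
  refine ⟨g, h, fun v => ?_, fun v => ?_⟩
  · rw [hx, hg]; rfl
  · rw [hx]; exact he (x.rangeRestrict v)

/-- The set `Z_i` of pairs `(x, y)` with `rank x = i` and `y` a nonzero covector
annihilating `ker x` is a single orbit of `GL(q,ℂ) × GL(p,ℂ)` on
`Hom(ℂᵖ, ℂ^q) ⊕ ℂ^{p*}`. -/
theorem rank_covector_pair_orbit (p q i : ℕ) (hp : 0 < p) (hq : 0 < q)
    (hi : 0 < i) (hipq : i ≤ min p q)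
    (x x' : Matrix (Fin q) (Fin p) ℂ) (hrx : x.rank = i) (hrx' : x'.rank = i)
    (y y' : Fin p → ℂ) (hy : y ≠ 0) (hy' : y' ≠ 0)
    (hyx : y ∈ LinearMap.range xᵀ.mulVecLin)
    (hyx' : y' ∈ LinearMap.range x'ᵀ.mulVecLin) :
    ∃ (g : Matrix (Fin q) (Fin q) ℂ) (h : Matrix (Fin p) (Fin p) ℂ),
      IsUnit g ∧ IsUnit h ∧ x' = g * x * h⁻¹ ∧ y' = Matrix.vecMul y h⁻¹ := by
  obtain ⟨c, rfl⟩ := hyx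
  obtain ⟨c', rfl⟩ := hyx'
  have hdual : ∀ (z : Matrix (Fin q) (Fin p) ℂ) (d : Fin q → ℂ), zᵀ.mulVecLin d ≠ 0 →
      dotProductBilin ℂ ℂ d ∘ₗ z.mulVecLin ≠ 0 := by
    intro z d hd h0
    refine hd (dotProduct_eq_zero _ fun w => ?_)
    have := LinearMap.congr_fun h0 w
    simpa [Matrix.mulVec_transpose, Matrix.dotProduct_mulVec] using this
  obtain ⟨g, h, hg, hh⟩ := LinearMap.exists_linearEquiv_intertwining x.mulVecLin x'.mulVecLin
    _ _ (hrx.trans hrx'.symm) (hdual x c hy) (hdual x' c' hy')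
  have hunit : ∀ {n : ℕ} (f : (Fin n → ℂ) ≃ₗ[ℂ] (Fin n → ℂ)),
      IsUnit (LinearMap.toMatrix' f.toLinearMap) := fun f =>
    (Matrix.isUnit_iff_isUnit_det _).2 (by simpa using f.isUnit_det')
  have hdet := (Matrix.isUnit_iff_isUnit_det _).1 (hunit h)
  refine ⟨LinearMap.toMatrix' g.toLinearMap, LinearMap.toMatrix' h.toLinearMap, hunit g, hunit h,
    ?_, ?_⟩
  · have hmul : x' * LinearMap.toMatrix' h.toLinearMap = LinearMap.toMatrix' g.toLinearMap * x := by
      refine Matrix.mulVec_injective (funext fun v => ?_)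
      simpa [← Matrix.mulVec_mulVec, LinearMap.toMatrix'_mulVec] using hg v
    rw [← hmul, Matrix.mul_nonsing_inv_cancel_right _ _ hdet]
  · have hvec : x'ᵀ.mulVecLin c' ᵥ* LinearMap.toMatrix' h.toLinearMap = xᵀ.mulVecLin c := by
      refine dotProduct_eq _ _ fun v => ?_
      simpa [← Matrix.dotProduct_mulVec, ← Matrix.mulVec_mulVec,
        LinearMap.toMatrix'_mulVec, Matrix.mulVec_transpose]
        using hh v
    rw [← hvec, Matrix.vecMul_vecMul, Matrix.mul_nonsing_inv _ hdet, Matrix.vecMul_one]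
end

section
/- Let n, m be positive integers. Let x, x' be complex n×2 matrices of rank 1 and y, y' complex 2×m matrices of rank 1, with x·y = 0 and x'·y' = 0. Then there exist g ∈ GL(n,ℂ), h ∈ SL(2,ℂ), and k ∈ GL(m,ℂ) such that x' = g·x·h⁻¹ and y' = h·y·k⁻¹. (The set Z₁₁ = {(x,y) : rank x = 1, rank y = 1, Im y ⊆ ker x} is a single orbit of GL(n,ℂ)×SL(2,ℂ)×GL(m,ℂ) on Hom(ℂ²,ℂⁿ) ⊕ Hom(ℂᵐ,ℂ²).) -/
open Matrix

/-- A matrix of rank one is the outer product of two nonzero vectors. -/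
lemma exists_vecMulVec_of_rank_eq_one {K ι κ : Type*} [Field K] [Fintype ι] [Fintype κ]
    {A : Matrix ι κ K} (hA : A.rank = 1) :
    ∃ (u : ι → K) (v : κ → K), u ≠ 0 ∧ v ≠ 0 ∧ A = vecMulVec u v := by
  classical
  obtain ⟨⟨u, hu⟩, hu0, hspan⟩ := finrank_eq_one_iff'.mp hA
  choose v hv using fun j => hspan ⟨A *ᵥ Pi.single j 1, LinearMap.mem_range_self A.mulVecLin _⟩
  have hAv : A = vecMulVec u v := by
    ext i j
    have h := congrFun (congrArg Subtype.val (hv j)) i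
    simp only [mulVec_single_one, SetLike.mk_smul_mk, Pi.smul_apply, smul_eq_mul, col_apply] at h
    rw [vecMulVec_apply, mul_comm, h]
  refine ⟨u, v, fun h => hu0 (Subtype.ext h), ?_, hAv⟩
  rintro rfl
  have hA0 : A = 0 := by
    ext i j
    simp [hAv, vecMulVec_apply]
  simp [hA0] at hA

/-- Invertible complex matrices act transitively on nonzero column vectors. -/
lemma exists_isUnit_mulVec_eq {ι : Type*} [Fintype ι] [DecidableEq ι] {u u' : ι → ℂ}
    (hu : u ≠ 0) (hu' : u' ≠ 0) : ∃ g : Matrix ι ι ℂ, IsUnit g ∧ g *ᵥ u = u' := by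
  obtain ⟨e, he⟩ := SeparatingDual.exists_continuousLinearEquiv_apply_eq (R := ℂ) hu hu'
  refine ⟨LinearMap.toMatrix' (e.toLinearEquiv : (ι → ℂ) →ₗ[ℂ] ι → ℂ), ?_, ?_⟩
  · rw [LinearMap.isUnit_toMatrix'_iff, Module.End.isUnit_iff]
    exact e.bijective
  · simpa [LinearMap.toMatrix'_mulVec] using he

/-- Every nonzero vector in the plane is the first column of a matrix of determinant one. -/
lemma exists_det_eq_one_mulVec_single {K : Type*} [Field K] {w : Fin 2 → K} (hw : w ≠ 0) :
    ∃ h : Matrix (Fin 2) (Fin 2) K, h.det = 1 ∧ h *ᵥ ![1, 0] = w := by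
  by_cases h0 : w 0 = 0
  · have h1 : w 1 ≠ 0 := fun h1 => hw (by ext i; fin_cases i <;> simp [h0, h1])
    refine ⟨!![0, -(w 1)⁻¹; w 1, 0], by simp [det_fin_two, h1], ?_⟩
    ext i; fin_cases i <;> simp [h0]
  · refine ⟨!![w 0, 0; w 1, (w 0)⁻¹], by simp [det_fin_two, h0], ?_⟩
    ext i; fin_cases i <;> simp

/-- `SL₂` acts transitively on nonzero vectors of the plane. -/
lemma exists_det_eq_one_mulVec_eq {K : Type*} [Field K] {w w' : Fin 2 → K}
    (hw : w ≠ 0) (hw' : w' ≠ 0) :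
    ∃ h : Matrix (Fin 2) (Fin 2) K, h.det = 1 ∧ h *ᵥ w = w' := by
  obtain ⟨a, ha, rfl⟩ := exists_det_eq_one_mulVec_single hw
  obtain ⟨b, hb, rfl⟩ := exists_det_eq_one_mulVec_single hw'
  refine ⟨b * a⁻¹, by simp [ha, hb, det_nonsing_inv], ?_⟩
  rw [mulVec_mulVec, Matrix.mul_assoc, nonsing_inv_mul a (by simp [ha]), Matrix.mul_one]

/-- `SL₂` preserves the area form: the covector dual to `w` is carried to the one dual to
`h *ᵥ w`. -/
lemma areaCovector_vecMul_inv {K : Type*} [Field K] {h : Matrix (Fin 2) (Fin 2) K}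
    (hh : h.det = 1) (w : Fin 2 → K) :
    ![-w 1, w 0] ᵥ* h⁻¹ = ![-(h *ᵥ w) 1, (h *ᵥ w) 0] := by
  have hform : ![-(h *ᵥ w) 1, (h *ᵥ w) 0] ᵥ* h = ![-w 1, w 0] := by
    rw [det_fin_two] at hh
    ext i
    fin_cases i <;> simp [mulVec, vecMul, dotProduct, Fin.sum_univ_two] <;> grind
  rw [← hform, vecMul_vecMul, mul_nonsing_inv h (by simp [hh]), vecMul_one]

/-- A covector annihilating a nonzero vector `w` of the plane is a multiple of `![-w 1, w 0]`. -/
lemma exists_eq_smul_of_dotProduct_eq_zero {K : Type*} [Field K] {v w : Fin 2 → K}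
    (hw : w ≠ 0) (hvw : v ⬝ᵥ w = 0) : ∃ c : K, v = c • ![-w 1, w 0] := by
  simp only [dotProduct, Fin.sum_univ_two] at hvw
  by_cases h0 : w 0 = 0
  · have h1 : w 1 ≠ 0 := fun h1 => hw (by ext i; fin_cases i <;> simp [h0, h1])
    refine ⟨-v 0 / w 1, ?_⟩
    ext i; fin_cases i <;> simp <;> grind
  · refine ⟨v 1 / w 0, ?_⟩
    ext i; fin_cases i <;> simp <;> grind

/-- Normal form of a pair of composable rank-one maps through the plane with zero composite. -/
lemma exists_normal_form_of_rank_eq_one {K ι κ : Type*} [Field K] [Fintype ι] [Fintype κ]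
    {x : Matrix ι (Fin 2) K} {y : Matrix (Fin 2) κ K}
    (hx : x.rank = 1) (hy : y.rank = 1) (hxy : x * y = 0) :
    ∃ (u : ι → K) (w : Fin 2 → K) (z : κ → K), u ≠ 0 ∧ w ≠ 0 ∧ z ≠ 0 ∧
      x = vecMulVec u ![-w 1, w 0] ∧ y = vecMulVec w z := by
  obtain ⟨u, v, hu, hv, rfl⟩ := exists_vecMulVec_of_rank_eq_one hx
  obtain ⟨w, z, hw, hz, rfl⟩ := exists_vecMulVec_of_rank_eq_one hy
  have hvw : v ⬝ᵥ w = 0 := by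
    obtain ⟨i, hi⟩ := Function.ne_iff.mp hu
    obtain ⟨j, hj⟩ := Function.ne_iff.mp hz
    have hij := congrFun (congrFun hxy i) j
    rw [vecMulVec_mul_vecMulVec] at hij
    simp_all [vecMulVec_apply]
  obtain ⟨c, rfl⟩ := exists_eq_smul_of_dotProduct_eq_zero hw hvw
  have hc : c ≠ 0 := by
    rintro rfl
    simp at hv
  refine ⟨c • u, w, z, smul_ne_zero hc hu, hw, hz, ?_, rfl⟩
  rw [vecMulVec_smul, smul_vecMulVec]

/-- The set `Z₁₁` of pairs `(x, y)` of rank-one maps with `Im y ⊆ ker x` is a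
single orbit of `GL(n,ℂ) × SL(2,ℂ) × GL(m,ℂ)` on
`Hom(ℂ², ℂⁿ) ⊕ Hom(ℂᵐ, ℂ²)`. -/
theorem rank_one_chain_orbit (n m : ℕ) (hn : 0 < n) (hm : 0 < m)
    (x x' : Matrix (Fin n) (Fin 2) ℂ) (hrx : x.rank = 1) (hrx' : x'.rank = 1)
    (y y' : Matrix (Fin 2) (Fin m) ℂ) (hry : y.rank = 1) (hry' : y'.rank = 1)
    (hxy : x * y = 0) (hxy' : x' * y' = 0) :
    ∃ (g : Matrix (Fin n) (Fin n) ℂ) (h : Matrix (Fin 2) (Fin 2) ℂ)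
      (k : Matrix (Fin m) (Fin m) ℂ),
      IsUnit g ∧ h.det = 1 ∧ IsUnit k ∧
      x' = g * x * h⁻¹ ∧ y' = h * y * k⁻¹ := by
  obtain ⟨u, w, z, hu, hw, hz, rfl, rfl⟩ := exists_normal_form_of_rank_eq_one hrx hry hxy
  obtain ⟨u', w', z', hu', hw', hz', rfl, rfl⟩ := exists_normal_form_of_rank_eq_one hrx' hry' hxy'
  obtain ⟨g, hg, rfl⟩ := exists_isUnit_mulVec_eq hu hu'
  obtain ⟨h, hh, rfl⟩ := exists_det_eq_one_mulVec_eq hw hw'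
  obtain ⟨k, hk, rfl⟩ := exists_isUnit_mulVec_eq hz' hz
  have hkt : IsUnit kᵀ := (isUnit_transpose k).mpr hk
  refine ⟨g, h, kᵀ, hg, hh, hkt, ?_, ?_⟩
  · rw [mul_vecMulVec, vecMulVec_mul, areaCovector_vecMul_inv hh]
  · rw [mul_vecMulVec, vecMulVec_mul, ← vecMul_transpose k, vecMul_vecMul,
      mul_nonsing_inv _ ((isUnit_iff_isUnit_det _).mp hkt), vecMul_one]
end
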